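/- arXiv:1010.3654 — 2 statements merged into one kernel-verified Lean document; each statement's English description precedes it below -/
import Mathlib

section
/- Let d ≥ 1, t ≥ 1 and let μ_H be the Haar probability measure on the group U(d) of d×d complex unitary matrices. Then for any fixed indices i, j ∈ [d], ∫_{U(d)} |U_{i,j}|^{2t} dμ_H(U) = C(d+t−1, t)^{−1} = t!·(d−1)!/(d+t−1)!, where C(d+t−1,t) is the binomial coefficient. -/
open MeasureTheory
open scoped BigOperators

/-- Borel measurable-space structure on the unitary group `U(d)` (as a subtype of matrices,
with its natural topology). -/
noncomputable instance unitaryGroup.measurableSpace (d : ℕ) :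
    MeasurableSpace (Matrix.unitaryGroup (Fin d) ℂ) := borel _

instance unitaryGroup.borelSpace (d : ℕ) :
    BorelSpace (Matrix.unitaryGroup (Fin d) ℂ) := ⟨rfl⟩


noncomputable section HaarHelpers

/-- The plane rotation in coordinates `a, b`. -/
def rotMat {d : ℕ} (a b : Fin d) (c s : ℂ) : Matrix (Fin d) (Fin d) ℂ :=
  1 + Matrix.single a a (c - 1) + Matrix.single b b (c - 1) + Matrix.single a b s
    + Matrix.single b a (-s)

theorem rotMat_mem {d : ℕ} {a b : Fin d} (hab : a ≠ b) (c s : ℝ) (h : c ^ 2 + s ^ 2 = 1) :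
    rotMat a b (c : ℂ) (s : ℂ) ∈ Matrix.unitaryGroup (Fin d) ℂ := by
  have h' : (c : ℂ) ^ 2 + (s : ℂ) ^ 2 = 1 := by exact_mod_cast h
  rw [Matrix.mem_unitaryGroup_iff]
  simp only [rotMat, Matrix.star_eq_conjTranspose, Matrix.conjTranspose_add,
    Matrix.conjTranspose_single, Matrix.conjTranspose_one, mul_add, add_mul, one_mul, mul_one,
    Matrix.single_mul_single_same, Matrix.single_mul_single_of_ne _ _ _ _ hab,
    Matrix.single_mul_single_of_ne _ _ _ _ hab.symm]
  ext x y
  simp only [Matrix.add_apply, Matrix.single_apply, Matrix.zero_apply]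
  simp only [RCLike.star_def, map_sub, map_neg, map_one, Complex.conj_ofReal]
  by_cases h1 : a = x
  · subst h1
    by_cases h3 : a = y
    · subst h3
      simp [hab.symm]
      linear_combination h'
    · by_cases h4 : b = y
      · subst h4
        simp [hab, hab.symm]
        try ring
      · simp [h3, h4]
  · by_cases h2 : b = x
    · subst h2
      by_cases h3 : a = y
      · subst h3
        simp [hab, hab.symm]
        try ring
      · by_cases h4 : b = y
        · subst h4
          simp [hab]
          linear_combination h'
        · simp [h3, h4]
    · simp [h1, h2]

theorem rotMat_mul {d : ℕ} {a b : Fin d} (hab : a ≠ b) (c s : ℂ) (U : Matrix (Fin d) (Fin d) ℂ)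
    (j : Fin d) : (rotMat a b c s * U) a j = c * U a j + s * U b j := by
  simp [rotMat, add_mul, Matrix.single_mul_apply_of_ne, hab, hab.symm]
  ring

def phaseMat {d : ℕ} (b : Fin d) (w : ℂ) : Matrix (Fin d) (Fin d) ℂ :=
  Matrix.diagonal (Function.update 1 b w)

theorem phaseMat_mem {d : ℕ} (b : Fin d) (w : ℂ) (h : w * (starRingEnd ℂ) w = 1) :
    phaseMat b w ∈ Matrix.unitaryGroup (Fin d) ℂ := by
  rw [Matrix.mem_unitaryGroup_iff, Matrix.star_eq_conjTranspose, phaseMat,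
    Matrix.diagonal_conjTranspose, Matrix.diagonal_mul_diagonal, ← Matrix.diagonal_one]
  congr 1
  ext x
  by_cases hx : x = b
  · subst hx; simpa using h
  · simp [hx]

theorem phaseMat_mul {d : ℕ} (b : Fin d) (w : ℂ) (U : Matrix (Fin d) (Fin d) ℂ)
    (j : Fin d) : (phaseMat b w * U) b j = w * U b j := by
  simp [phaseMat]

theorem phaseMat_mul_ne {d : ℕ} {a b : Fin d} (hab : a ≠ b) (w : ℂ)
    (U : Matrix (Fin d) (Fin d) ℂ)
    (j : Fin d) : (phaseMat b w * U) a j = U a j := by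
  simp [phaseMat, hab]

theorem entry_cont {d : ℕ} (a j : Fin d) :
    Continuous (fun U : Matrix.unitaryGroup (Fin d) ℂ => (U : Matrix (Fin d) (Fin d) ℂ) a j) := by
  exact (continuous_id.matrix_elem a j).comp continuous_subtype_val

theorem entry_le {d : ℕ} (a j : Fin d) (U : Matrix.unitaryGroup (Fin d) ℂ) :
    ‖(U : Matrix (Fin d) (Fin d) ℂ) a j‖ ≤ 1 := entry_norm_bound_of_unitary U.2 a j

open ComplexConjugate

/-- the mixed monomial -/
def mono {d : ℕ} (a b j : Fin d) (p q r s : ℕ) (U : Matrix.unitaryGroup (Fin d) ℂ) : ℂ :=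
  (U : Matrix (Fin d) (Fin d) ℂ) a j ^ p * (U : Matrix (Fin d) (Fin d) ℂ) b j ^ q *
    (conj ((U : Matrix (Fin d) (Fin d) ℂ) a j) ^ r * conj ((U : Matrix (Fin d) (Fin d) ℂ) b j) ^ s)

section
variable {d : ℕ} (μ : Measure (Matrix.unitaryGroup (Fin d) ℂ))
    [μ.IsHaarMeasure] [IsProbabilityMeasure μ]

theorem mono_integrable (a b j : Fin d) (p q r s : ℕ) : Integrable (mono a b j p q r s) μ := by
  have hc : Continuous (mono a b j p q r s) := by
    have h1 := entry_cont a j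
    have h2 := entry_cont b j
    have h3 := Complex.continuous_conj.comp h1
    have h4 := Complex.continuous_conj.comp h2
    exact ((h1.pow p).mul (h2.pow q)).mul ((h3.pow r).mul (h4.pow s))
  refine Integrable.of_bound hc.measurable.aestronglyMeasurable 1 (Filter.Eventually.of_forall ?_)
  intro U
  have ha := entry_le a j U
  have hb := entry_le b j U
  simp only [mono, norm_mul, norm_pow, RCLike.norm_conj]
  have n1 := norm_nonneg ((U : Matrix (Fin d) (Fin d) ℂ) a j)
  have n2 := norm_nonneg ((U : Matrix (Fin d) (Fin d) ℂ) b j)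
  exact mul_le_one₀ (mul_le_one₀ (pow_le_one₀ n1 ha) (by positivity) (pow_le_one₀ n2 hb))
    (by positivity) (mul_le_one₀ (pow_le_one₀ n1 ha) (by positivity) (pow_le_one₀ n2 hb))

theorem haar_inv {E : Type*} [NormedAddCommGroup E] [NormedSpace ℝ E]
    (f : Matrix.unitaryGroup (Fin d) ℂ → E) (V : Matrix.unitaryGroup (Fin d) ℂ) :
    ∫ U, f (V * U) ∂μ = ∫ U, f U ∂μ := integral_mul_left_eq_self f V

theorem mono_zero {a b : Fin d} (hab : a ≠ b) (j : Fin d) (p q r s : ℕ) (hqs : q ≠ s) :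
    ∫ U, mono a b j p q r s U ∂μ = 0 := by
  set w : ℂ := Complex.exp (Real.pi * Complex.I / ((q : ℂ) - s)) with hw
  have hne : (q : ℂ) - s ≠ 0 := sub_ne_zero.2 (by exact_mod_cast hqs)
  have hwc : conj w = Complex.exp (-(Real.pi * Complex.I / ((q : ℂ) - s))) := by
    rw [hw, ← Complex.exp_conj]
    congr 1
    simp [neg_div]
  have h1 : w * conj w = 1 := by
    rw [hwc, hw, ← Complex.exp_add]; simp
  have h2 : w ^ q * conj w ^ s = -1 := by
    rw [hwc, hw, ← Complex.exp_nat_mul, ← Complex.exp_nat_mul, ← Complex.exp_add,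
      ← Complex.exp_pi_mul_I]
    congr 1
    field_simp
    ring
  have h3 := haar_inv μ (mono a b j p q r s) ⟨phaseMat b w, phaseMat_mem b w h1⟩
  have h4 : ∀ U, mono a b j p q r s (⟨phaseMat b w, phaseMat_mem b w h1⟩ * U)
      = - mono a b j p q r s U := by
    intro U
    simp only [mono, Submonoid.coe_mul, phaseMat_mul, phaseMat_mul_ne hab, map_mul, mul_pow]
    linear_combination ((U : Matrix (Fin d) (Fin d) ℂ) a j ^ p *
      (U : Matrix (Fin d) (Fin d) ℂ) b j ^ q *
    (conj ((U : Matrix (Fin d) (Fin d) ℂ) a j) ^ r *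
      conj ((U : Matrix (Fin d) (Fin d) ℂ) b j) ^ s)) * h2
  simp only [h4, integral_neg] at h3
  exact self_eq_neg.1 h3.symm

theorem rot_eq {a b : Fin d} (hab : a ≠ b) (j : Fin d) (n : ℕ) (x : ℝ) :
    ∫ U : Matrix.unitaryGroup (Fin d) ℂ, ((U : Matrix (Fin d) (Fin d) ℂ) a j + x * (U : Matrix (Fin d) (Fin d) ℂ) b j) ^ n *
      conj ((U : Matrix (Fin d) (Fin d) ℂ) a j + x * (U : Matrix (Fin d) (Fin d) ℂ) b j) ^ n ∂μ
    = (1 + (x : ℂ) ^ 2) ^ n * ∫ U, mono a b j n 0 n 0 U ∂μ := by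
  have hpos : 0 < 1 + x ^ 2 := by positivity
  set c : ℝ := (Real.sqrt (1 + x ^ 2))⁻¹ with hc
  have hc2 : c ^ 2 * (1 + x ^ 2) = 1 := by
    rw [hc, inv_pow, Real.sq_sqrt hpos.le, inv_mul_cancel₀ hpos.ne']
  have hcs : c ^ 2 + (c * x) ^ 2 = 1 := by linear_combination hc2
  have hC : (c : ℂ) ^ 2 * (1 + (x : ℂ) ^ 2) = 1 := by exact_mod_cast hc2
  rw [← haar_inv μ (mono a b j n 0 n 0) ⟨rotMat a b _ _, rotMat_mem hab c (c * x) hcs⟩,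
    ← integral_const_mul]
  congr 1
  ext U
  simp only [mono, Submonoid.coe_mul, rotMat_mul hab, pow_zero, mul_one, Complex.ofReal_mul,
    map_mul, map_add, Complex.conj_ofReal]
  rw [← mul_pow, ← mul_pow, ← mul_pow]
  congr 1
  linear_combination -((U : Matrix (Fin d) (Fin d) ℂ) a j +
    x * (U : Matrix (Fin d) (Fin d) ℂ) b j) * (conj ((U : Matrix (Fin d) (Fin d) ℂ) a j) +
    x * conj ((U : Matrix (Fin d) (Fin d) ℂ) b j)) * hC

theorem expand_eq {a b : Fin d} (hab : a ≠ b) (j : Fin d) (n : ℕ) (x : ℝ) :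
    ∫ U : Matrix.unitaryGroup (Fin d) ℂ, ((U : Matrix (Fin d) (Fin d) ℂ) a j + x * (U : Matrix (Fin d) (Fin d) ℂ) b j) ^ n *
      conj ((U : Matrix (Fin d) (Fin d) ℂ) a j + x * (U : Matrix (Fin d) (Fin d) ℂ) b j) ^ n ∂μ
    = ∑ k ∈ Finset.range (n + 1), ((n.choose k : ℂ) ^ 2 * ∫ U, mono a b j (n - k) k (n - k) k U ∂μ)
        * ((x : ℂ) ^ 2) ^ k := by
  have h1 : ∀ U : Matrix.unitaryGroup (Fin d) ℂ,
      ((U : Matrix (Fin d) (Fin d) ℂ) a j + x * (U : Matrix (Fin d) (Fin d) ℂ) b j) ^ n *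
      conj ((U : Matrix (Fin d) (Fin d) ℂ) a j + x * (U : Matrix (Fin d) (Fin d) ℂ) b j) ^ n
      = ∑ k ∈ Finset.range (n + 1), ∑ l ∈ Finset.range (n + 1),
        ((n.choose k : ℂ) * n.choose l * x ^ k * x ^ l) * mono a b j (n - k) k (n - l) l U := by
    intro U
    rw [map_add, add_comm, add_comm (conj _), add_pow, add_pow, Finset.sum_mul_sum]
    refine Finset.sum_congr rfl fun k _ => Finset.sum_congr rfl fun l _ => ?_
    simp only [mono, map_mul, Complex.conj_ofReal, mul_pow]
    ring
  simp only [h1]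
  rw [integral_finset_sum _ fun k _ => integrable_finset_sum _ fun l _ =>
    (mono_integrable μ a b j _ _ _ _).const_mul _]
  refine Finset.sum_congr rfl fun k hk => ?_
  rw [integral_finset_sum _ fun l _ => (mono_integrable μ a b j _ _ _ _).const_mul _]
  rw [Finset.sum_eq_single_of_mem k hk]
  · rw [integral_const_mul]; ring
  · intro l _ hl
    rw [integral_const_mul, mono_zero μ hab j _ _ _ _ hl.symm, mul_zero]

open Polynomial in
theorem cross_eq {a b : Fin d} (hab : a ≠ b) (j : Fin d) (n : ℕ) :
    ((n : ℂ) + 1) * ∫ U, mono a b j n 1 n 1 U ∂μ = ∫ U, mono a b j (n + 1) 0 (n + 1) 0 U ∂μ := by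
  set m := ∫ U, mono a b j (n + 1) 0 (n + 1) 0 U ∂μ with hm
  set P : ℂ[X] := ∑ k ∈ Finset.range (n + 1 + 1), C (((n + 1).choose k : ℂ) ^ 2 *
    ∫ U, mono a b j (n + 1 - k) k (n + 1 - k) k U ∂μ) * X ^ k with hP
  set Q : ℂ[X] := C m * (X + 1) ^ (n + 1) with hQ
  have hPQ : P = Q := by
    apply Polynomial.eq_of_infinite_eval_eq
    refine Set.Infinite.mono (s := Set.range fun k : ℕ => ((k : ℝ) : ℂ) ^ 2) ?_ ?_
    · rintro _ ⟨k, rfl⟩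
      have h := (expand_eq μ hab j (n + 1) k).symm.trans (rot_eq μ hab j (n + 1) k)
      simp only [Set.mem_setOf_eq, hP, hQ, eval_finset_sum, eval_mul, eval_C, eval_pow, eval_X,
        eval_add, eval_one]
      rw [h]; ring
    · apply Set.infinite_range_of_injective
      intro k l h
      have h' : k ^ 2 = l ^ 2 := by
        have : ((k ^ 2 : ℕ) : ℂ) = ((l ^ 2 : ℕ) : ℂ) := by push_cast; simpa using h
        exact_mod_cast this
      exact Nat.pow_left_injective (by norm_num) h'
  have h := congrArg (fun p => p.coeff 1) hPQ
  simp only [hP, hQ, finsetSum_coeff, coeff_C_mul, coeff_X_pow, coeff_X_add_one_pow] at h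
  rw [Finset.sum_eq_single_of_mem 1 (by simp)
    (by intro k _ hk; rw [if_neg (Ne.symm hk), mul_zero])] at h
  simp only [if_true, Nat.choose_one_right, Nat.add_sub_cancel, mul_one] at h
  have hn : ((n : ℂ) + 1) ≠ 0 := by exact_mod_cast Nat.succ_ne_zero n
  push_cast at h
  apply mul_left_cancel₀ hn
  linear_combination h

theorem mono_diag (a b j : Fin d) (p q : ℕ) (U : Matrix.unitaryGroup (Fin d) ℂ) :
    mono a b j p q p q U = ((‖(U : Matrix (Fin d) (Fin d) ℂ) a j‖ ^ (2 * p) *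
      ‖(U : Matrix (Fin d) (Fin d) ℂ) b j‖ ^ (2 * q) : ℝ) : ℂ) := by
  simp only [mono]
  push_cast
  rw [pow_mul, pow_mul, ← Complex.mul_conj', ← Complex.mul_conj']
  ring

theorem cross_real {a b : Fin d} (hab : a ≠ b) (j : Fin d) (n : ℕ) :
    ((n : ℝ) + 1) * ∫ U : Matrix.unitaryGroup (Fin d) ℂ,
      ‖(U : Matrix (Fin d) (Fin d) ℂ) a j‖ ^ (2 * n) *
      ‖(U : Matrix (Fin d) (Fin d) ℂ) b j‖ ^ 2 ∂μ =
    ∫ U : Matrix.unitaryGroup (Fin d) ℂ,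
      ‖(U : Matrix (Fin d) (Fin d) ℂ) a j‖ ^ (2 * (n + 1)) ∂μ := by
  have h := cross_eq μ hab j n
  simp only [mono_diag, integral_complex_ofReal, mul_one, mul_zero, pow_zero] at h
  exact_mod_cast h

theorem int_real (a b j : Fin d) (n : ℕ) : Integrable (fun U : Matrix.unitaryGroup (Fin d) ℂ =>
      ‖(U : Matrix (Fin d) (Fin d) ℂ) a j‖ ^ (2 * n) *
      ‖(U : Matrix (Fin d) (Fin d) ℂ) b j‖ ^ 2) μ := by
  have h := (mono_integrable μ a b j n 1 n 1).re
  refine h.congr (Filter.Eventually.of_forall fun U => ?_)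
  simp only [mono_diag, mul_one]
  exact Complex.ofReal_re _

theorem col_sum (j : Fin d) (U : Matrix.unitaryGroup (Fin d) ℂ) :
    ∑ k, ‖(U : Matrix (Fin d) (Fin d) ℂ) k j‖ ^ 2 = 1 := by
  have h := congrFun (congrFun (Matrix.mem_unitaryGroup_iff'.1 U.2) j) j
  simp only [Matrix.mul_apply, Matrix.star_apply, Matrix.one_apply_eq, RCLike.star_def,
    Complex.conj_mul'] at h
  exact_mod_cast h

theorem rec_real (a j : Fin d) (n : ℕ) :
    ((n : ℝ) + 1) * ∫ U : Matrix.unitaryGroup (Fin d) ℂ,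
      ‖(U : Matrix (Fin d) (Fin d) ℂ) a j‖ ^ (2 * n) ∂μ =
    ((d : ℝ) + n) * ∫ U : Matrix.unitaryGroup (Fin d) ℂ,
      ‖(U : Matrix (Fin d) (Fin d) ℂ) a j‖ ^ (2 * (n + 1)) ∂μ := by
  set m := ∫ U : Matrix.unitaryGroup (Fin d) ℂ,
      ‖(U : Matrix (Fin d) (Fin d) ℂ) a j‖ ^ (2 * (n + 1)) ∂μ with hm
  have h1 : ∫ U : Matrix.unitaryGroup (Fin d) ℂ,
      ‖(U : Matrix (Fin d) (Fin d) ℂ) a j‖ ^ (2 * n) ∂μ =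
      ∑ k, ∫ U : Matrix.unitaryGroup (Fin d) ℂ, ‖(U : Matrix (Fin d) (Fin d) ℂ) a j‖ ^ (2 * n) *
      ‖(U : Matrix (Fin d) (Fin d) ℂ) k j‖ ^ 2 ∂μ := by
    rw [← integral_finset_sum _ fun k _ => int_real μ a k j n]
    congr 1
    ext U
    rw [← Finset.mul_sum, col_sum, mul_one]
  rw [h1, Finset.mul_sum, ← Finset.add_sum_erase _ _ (Finset.mem_univ a),
    Finset.sum_congr rfl fun k hk => cross_real μ (Finset.ne_of_mem_erase hk).symm j n,
    Finset.sum_const, Finset.card_erase_of_mem (Finset.mem_univ a), Finset.card_univ,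
    Fintype.card_fin, ← hm]
  have h2 : ∫ U : Matrix.unitaryGroup (Fin d) ℂ, ‖(U : Matrix (Fin d) (Fin d) ℂ) a j‖ ^ (2 * n) *
      ‖(U : Matrix (Fin d) (Fin d) ℂ) a j‖ ^ 2 ∂μ = m := by
    simp only [hm, ← pow_add, mul_add, mul_one]
  have hd : 1 ≤ d := a.pos
  rw [h2, nsmul_eq_mul, Nat.cast_sub hd]
  push_cast
  ring

end

end HaarHelpers

/-- For the Haar probability measure `μ_H` on `U(d)` and any fixed entry `(i,j)`,
`∫ |U_{i,j}|^{2t} dμ_H(U) = C(d+t-1, t)⁻¹`. -/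
theorem haar_moment_entry (d t : ℕ) (hd : 1 ≤ d) (ht : 1 ≤ t)
    (μH : Measure (Matrix.unitaryGroup (Fin d) ℂ))
    [μH.IsHaarMeasure] [IsProbabilityMeasure μH] (i j : Fin d) :
    ∫ U : Matrix.unitaryGroup (Fin d) ℂ,
        ‖(U : Matrix (Fin d) (Fin d) ℂ) i j‖ ^ (2 * t) ∂μH
      = ((d + t - 1).choose t : ℝ)⁻¹ := by
  clear ht
  obtain ⟨e, rfl⟩ : ∃ e, d = e + 1 := ⟨d - 1, by omega⟩
  induction t with
  | zero => simp
  | succ n ih =>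
    have h := rec_real μH i j n
    rw [ih] at h
    have hc := Nat.add_one_mul_choose_eq (e + n) n
    have e1 : e + 1 + n - 1 = e + n := by omega
    have e2 : e + 1 + (n + 1) - 1 = e + n + 1 := by omega
    rw [e1] at h
    rw [e2]
    have hc' : ((e : ℝ) + n + 1) * (e + n).choose n = (e + n + 1).choose (n + 1) * (n + 1) := by
      exact_mod_cast hc
    have p1 : (((e + n).choose n : ℕ) : ℝ) ≠ 0 := by
      exact_mod_cast (Nat.choose_pos (by omega)).ne'
    have p2 : (((e + n + 1).choose (n + 1) : ℕ) : ℝ) ≠ 0 := by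
      exact_mod_cast (Nat.choose_pos (by omega)).ne'
    have p3 : ((e : ℝ) + n + 1) ≠ 0 := by positivity
    apply mul_left_cancel₀ p3
    push_cast at h
    rw [show ((e : ℝ) + 1 + n) = e + n + 1 by ring] at h
    rw [← h]
    field_simp
    linear_combination -hc'
end

section
/- Let n, t ≥ 1, d = 2^n, and let μ be a probability measure on U(2^n) that is a 2^{−3tn}-approximate unitary t-design, i.e., for every d^t×d^t matrix X, ‖∫ U^{⊗t} X (U^†)^{⊗t} dμ − ∫ U^{⊗t} X (U^†)^{⊗t} dμ_H‖_2 ≤ 2^{−3tn} ‖X‖_2. Then for every β with 0 ≤ β ≤ 1, μ({U : max_{i,j} |U_{i,j}|² ≥ 2^{−βn}}) ≤ (1 + t!) · 2^{−(t(1−β)−2)n}. In other words, all but a (1+t!)·2^{−(t(1−β)−2)n} fraction of the elements of the design satisfy C(U) ≥ βn. -/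
open MeasureTheory
open scoped BigOperators Matrix

/-- The `t`-fold Kronecker (tensor) power of a matrix, indexed by tuples. -/
def tensorPow {d : ℕ} (t : ℕ) (A : Matrix (Fin d) (Fin d) ℂ) :
    Matrix (Fin t → Fin d) (Fin t → Fin d) ℂ :=
  fun x y => ∏ a : Fin t, A (x a) (y a)

/-- The Frobenius (Hilbert-Schmidt) norm of a matrix. -/
noncomputable def frobNorm {α : Type*} [Fintype α] (M : Matrix α α ℂ) : ℝ :=
  Real.sqrt (∑ x : α, ∑ y : α, ‖M x y‖ ^ 2)

/-- The `t`-th moment superoperator of a measure `ν` on `U(d)`, defined entrywise. -/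
noncomputable def momentSuper (d t : ℕ) (ν : Measure (Matrix.unitaryGroup (Fin d) ℂ))
    (X : Matrix (Fin t → Fin d) (Fin t → Fin d) ℂ) :
    Matrix (Fin t → Fin d) (Fin t → Fin d) ℂ :=
  fun x y =>
    ∫ U : Matrix.unitaryGroup (Fin d) ℂ,
      (tensorPow t (U : Matrix (Fin d) (Fin d) ℂ) * X *
        (tensorPow t (U : Matrix (Fin d) (Fin d) ℂ))ᴴ) x y ∂ν

open Finset in
lemma exists_perm_of_count {d t : ℕ} (p q : Fin t → Fin d)
    (h : ∀ k, #{a | p a = k} = #{a | q a = k}) : ∃ σ : Equiv.Perm (Fin t), q ∘ σ = p := by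
  have e : ∀ k, Nonempty ({a // p a = k} ≃ {a // q a = k}) := fun k => by
    refine Fintype.card_eq.1 ?_
    rw [Fintype.card_subtype, Fintype.card_subtype]
    exact h k
  refine ⟨Equiv.ofFiberEquiv fun k => (e k).some, ?_⟩
  funext a
  exact Equiv.ofFiberEquiv_map _ a

open Finset in
lemma char_rewrite {d t : ℕ} (z : ℂ) (p : Fin t → Fin d) (φ : Fin d → Fin (t + 1)) :
    ∏ a, z ^ (φ (p a) : ℕ) = ∏ k, (z ^ #{a | p a = k}) ^ (φ k : ℕ) := by
  rw [← Finset.prod_fiberwise Finset.univ p]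
  refine Finset.prod_congr rfl fun k _ => ?_
  rw [Finset.prod_congr rfl (g := fun _ => z ^ (φ k : ℕ))]
  · rw [Finset.prod_const, ← pow_mul, ← pow_mul, mul_comm]
  · intro a ha
    rw [(Finset.mem_filter.1 ha).2]

open Finset in
lemma char_sum_zero {d t : ℕ} {ζ : ℂ} (hζ : IsPrimitiveRoot ζ (t + 1)) (p q : Fin t → Fin d)
    (k : Fin d) (h : #{a | p a = k} ≠ #{a | q a = k}) :
    ∑ φ : Fin d → Fin (t + 1), (∏ a, ζ ^ (φ (p a) : ℕ)) * (∏ a, ζ⁻¹ ^ (φ (q a) : ℕ)) = 0 := by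
  simp only [char_rewrite, ← Finset.prod_mul_distrib, ← mul_pow]
  have := Finset.prod_univ_sum (fun _ : Fin d => (Finset.univ : Finset (Fin (t+1))))
    (fun k m => (ζ ^ #{a | p a = k} * ζ⁻¹ ^ #{a | q a = k}) ^ (m : ℕ))
  rw [Fintype.piFinset_univ] at this
  rw [← this]
  apply Finset.prod_eq_zero (Finset.mem_univ k)
  set w := ζ ^ #{a | p a = k} * ζ⁻¹ ^ #{a | q a = k} with hw
  have h0 : ζ ≠ 0 := hζ.ne_zero (by omega)
  have hw1 : w ≠ 1 := by
    intro h1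
    apply h
    refine hζ.pow_inj ?_ ?_ ?_
    · exact Nat.lt_succ_of_le ((Finset.card_le_univ _).trans (by simp))
    · exact Nat.lt_succ_of_le ((Finset.card_le_univ _).trans (by simp))
    · rw [hw, inv_pow] at h1
      exact (mul_inv_eq_one₀ (pow_ne_zero _ h0)).1 h1
  have hwt : w ^ (t + 1) = 1 := by
    rw [hw, mul_pow, ← pow_mul, ← pow_mul, mul_comm, mul_comm _ (t+1), mul_comm _ (t+1),
      pow_mul, pow_mul, hζ.pow_eq_one, inv_pow, hζ.pow_eq_one]
    simp
  rw [Fin.sum_univ_eq_sum_range (fun m => w ^ m)]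
  have := geom_sum_mul w (t + 1)
  rw [hwt, sub_self] at this
  exact (mul_eq_zero.1 this).resolve_right (sub_ne_zero.2 hw1)

open Finset in
lemma steinhaus {d t : ℕ} {ζ : ℂ} (hζ : IsPrimitiveRoot ζ (t + 1)) (v : Fin d → ℂ) :
    ∑ φ : Fin d → Fin (t + 1), ‖∑ k, ζ ^ (φ k : ℕ) * v k‖ ^ (2 * t) ≤
      ((t : ℝ) + 1) ^ d * (t.factorial * (∑ k, ‖v k‖ ^ 2) ^ t) := by
  classical
  have hn : ‖ζ‖ = 1 := hζ.norm'_eq_one (by omega)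
  have hconj : (starRingEnd ℂ) ζ = ζ⁻¹ := (Complex.inv_eq_conj hn).symm
  have expand : ((∑ φ : Fin d → Fin (t + 1), ‖∑ k, ζ ^ (φ k : ℕ) * v k‖ ^ (2 * t) : ℝ) : ℂ) =
      ∑ p : Fin t → Fin d, ∑ q : Fin t → Fin d,
        ((∏ a, v (p a)) * (∏ a, (starRingEnd ℂ) (v (q a)))) *
        ∑ φ : Fin d → Fin (t + 1), (∏ a, ζ ^ (φ (p a) : ℕ)) * (∏ a, ζ⁻¹ ^ (φ (q a) : ℕ)) := by
    have h1 : ∀ φ : Fin d → Fin (t + 1),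
        ((‖∑ k, ζ ^ (φ k : ℕ) * v k‖ ^ (2 * t) : ℝ) : ℂ) =
        ∑ p : Fin t → Fin d, ∑ q : Fin t → Fin d,
        ((∏ a, v (p a)) * (∏ a, (starRingEnd ℂ) (v (q a)))) *
          ((∏ a, ζ ^ (φ (p a) : ℕ)) * (∏ a, ζ⁻¹ ^ (φ (q a) : ℕ))) := by
      intro φ
      push_cast
      rw [pow_mul, ← Complex.mul_conj', mul_pow, map_sum, Fintype.sum_pow, Fintype.sum_pow,
        Finset.sum_mul_sum]
      refine Finset.sum_congr rfl fun p _ => Finset.sum_congr rfl fun q _ => ?_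
      simp only [map_mul, map_pow, hconj, Finset.prod_mul_distrib]
      ring
    push_cast at h1 ⊢
    rw [Finset.sum_congr rfl fun φ _ => h1 φ, Finset.sum_comm]
    refine Finset.sum_congr rfl fun p _ => ?_
    rw [Finset.sum_comm]
    refine Finset.sum_congr rfl fun q _ => ?_
    rw [Finset.mul_sum]
  set L := ∑ φ : Fin d → Fin (t + 1), ‖∑ k, ζ ^ (φ k : ℕ) * v k‖ ^ (2 * t) with hL
  have hL0 : 0 ≤ L := Finset.sum_nonneg fun _ _ => by positivity
  have hLn : L = ‖(L : ℂ)‖ := by rw [Complex.norm_real, Real.norm_of_nonneg hL0]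
  rw [hLn, expand]
  have key : ∀ p : Fin t → Fin d, ‖∑ q : Fin t → Fin d,
        ((∏ a, v (p a)) * (∏ a, (starRingEnd ℂ) (v (q a)))) *
        ∑ φ : Fin d → Fin (t + 1), (∏ a, ζ ^ (φ (p a) : ℕ)) * (∏ a, ζ⁻¹ ^ (φ (q a) : ℕ))‖ ≤
        ((t : ℝ) + 1) ^ d * (t.factorial * ∏ a, ‖v (p a)‖ ^ 2) := by
    intro p
    have hsub : ∀ q ∈ (Finset.univ : Finset (Fin t → Fin d)),
        q ∉ Finset.univ.image (fun σ : Equiv.Perm (Fin t) => p ∘ σ) →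
        ((∏ a, v (p a)) * (∏ a, (starRingEnd ℂ) (v (q a)))) *
        ∑ φ : Fin d → Fin (t + 1), (∏ a, ζ ^ (φ (p a) : ℕ)) * (∏ a, ζ⁻¹ ^ (φ (q a) : ℕ)) = 0 := by
      intro q _ hq
      have : ∃ k, #{a | p a = k} ≠ #{a | q a = k} := by
        by_contra! hcon
        obtain ⟨σ, hσ⟩ := exists_perm_of_count q p (fun k => (hcon k).symm)
        exact hq (Finset.mem_image.2 ⟨σ, Finset.mem_univ _, hσ⟩)
      obtain ⟨k, hk⟩ := this
      rw [char_sum_zero hζ p q k hk, mul_zero]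
    rw [← Finset.sum_subset (Finset.subset_univ _) hsub]
    refine (norm_sum_le _ _).trans ?_
    have hb : ∀ q ∈ Finset.univ.image (fun σ : Equiv.Perm (Fin t) => p ∘ σ),
      ‖((∏ a, v (p a)) * (∏ a, (starRingEnd ℂ) (v (q a)))) *
        ∑ φ : Fin d → Fin (t + 1), (∏ a, ζ ^ (φ (p a) : ℕ)) * (∏ a, ζ⁻¹ ^ (φ (q a) : ℕ))‖ ≤
        (∏ a, ‖v (p a)‖ ^ 2) * ((t : ℝ) + 1) ^ d := by
      intro q hq
      obtain ⟨σ, -, rfl⟩ := Finset.mem_image.1 hq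
      rw [norm_mul]
      refine mul_le_mul (le_of_eq ?_) ?_ (norm_nonneg _) (by positivity)
      · rw [norm_mul, norm_prod, norm_prod]
        simp only [RCLike.norm_conj, Function.comp_apply]
        rw [Equiv.prod_comp σ (fun a => ‖v (p a)‖), ← Finset.prod_mul_distrib]
        simp only [sq]
      · refine (norm_sum_le _ _).trans ?_
        simp [norm_prod, hn]
    refine (Finset.sum_le_card_nsmul _ _ _ hb).trans ?_
    rw [nsmul_eq_mul]
    have hc : ((#(Finset.univ.image (fun σ : Equiv.Perm (Fin t) => p ∘ σ)) : ℕ) : ℝ) ≤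
        t.factorial := by
      have := Finset.card_image_le (s := Finset.univ) (f := fun σ : Equiv.Perm (Fin t) => p ∘ σ)
      rw [Finset.card_univ, Fintype.card_perm, Fintype.card_fin] at this
      exact_mod_cast this
    have h0 : 0 ≤ (∏ a, ‖v (p a)‖ ^ 2) * ((t : ℝ) + 1) ^ d := by positivity
    nlinarith [mul_le_mul_of_nonneg_right hc h0]
  refine (norm_sum_le _ _).trans ((Finset.sum_le_sum fun p _ => key p).trans (le_of_eq ?_))
  rw [← Finset.mul_sum, ← Finset.mul_sum, Fintype.sum_pow]

/-- The discrete Fourier matrix with phases on the columns. -/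
noncomputable def phaseDFT (d : ℕ) (η : ℂ) (c : Fin d → ℂ) : Matrix (Fin d) (Fin d) ℂ :=
  fun i k => ((Real.sqrt d : ℝ) : ℂ)⁻¹ * η ^ ((i : ℕ) * (k : ℕ)) * c k

lemma phaseDFT_mem {d : ℕ} (hd : 0 < d) {η : ℂ} (hη : IsPrimitiveRoot η d) (c : Fin d → ℂ)
    (hc : ∀ k, ‖c k‖ = 1) : phaseDFT d η c ∈ Matrix.unitaryGroup (Fin d) ℂ := by
  have hn : ‖η‖ = 1 := hη.norm'_eq_one (by omega)
  have h0 : η ≠ 0 := hη.ne_zero (by omega)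
  have hconj : (starRingEnd ℂ) η = η⁻¹ := (Complex.inv_eq_conj hn).symm
  have hs : ((Real.sqrt d : ℝ) : ℂ)⁻¹ * ((Real.sqrt d : ℝ) : ℂ)⁻¹ = (d : ℂ)⁻¹ := by
    rw [← mul_inv, ← Complex.ofReal_mul, Real.mul_self_sqrt (by positivity)]
    simp
  rw [Matrix.mem_unitaryGroup_iff]
  ext i j
  rw [Matrix.mul_apply]
  have hterm : ∀ k : Fin d, phaseDFT d η c i k * (star (phaseDFT d η c)) k j =
      (d : ℂ)⁻¹ * (η ^ (i : ℕ) * η⁻¹ ^ (j : ℕ)) ^ (k : ℕ) := by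
    intro k
    have hck : c k * (starRingEnd ℂ) (c k) = 1 := by
      rw [Complex.mul_conj', hc]; simp
    rw [Matrix.star_apply]
    simp only [phaseDFT, RCLike.star_def, map_mul, map_pow, map_inv₀, Complex.conj_ofReal, hconj]
    rw [← hs, mul_pow, ← pow_mul, ← pow_mul]
    linear_combination (((Real.sqrt d : ℝ) : ℂ)⁻¹ * ((Real.sqrt d : ℝ) : ℂ)⁻¹ *
      η ^ ((i : ℕ) * (k : ℕ)) * η⁻¹ ^ ((j : ℕ) * (k : ℕ))) * hck
  rw [Finset.sum_congr rfl fun k _ => hterm k, ← Finset.mul_sum]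
  set w := η ^ (i : ℕ) * η⁻¹ ^ (j : ℕ) with hw
  rw [Fin.sum_univ_eq_sum_range (fun m => w ^ m)]
  by_cases hij : i = j
  · subst hij
    have : w = 1 := by rw [hw, ← mul_pow, mul_inv_cancel₀ h0, one_pow]
    have hd' : (d : ℂ) ≠ 0 := by exact_mod_cast hd.ne'
    simp [this, hd']
  · rw [Matrix.one_apply_ne hij]
    have hw1 : w ≠ 1 := by
      intro h1
      rw [hw, inv_pow] at h1
      exact hij (Fin.ext (hη.pow_inj i.2 j.2 ((mul_inv_eq_one₀ (pow_ne_zero _ h0)).1 h1)))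
    have hwt : w ^ d = 1 := by
      rw [hw, mul_pow, ← pow_mul, ← pow_mul, mul_comm, mul_comm _ d, mul_comm _ d,
        pow_mul, pow_mul, hη.pow_eq_one, inv_pow, hη.pow_eq_one]
      simp
    have := geom_sum_mul w d
    rw [hwt, sub_self] at this
    rw [(mul_eq_zero.1 this).resolve_right (sub_ne_zero.2 hw1), mul_zero]

lemma continuous_entry {d : ℕ} (i j : Fin d) :
    Continuous (fun U : Matrix.unitaryGroup (Fin d) ℂ => (U : Matrix (Fin d) (Fin d) ℂ) i j) :=
  Continuous.matrix_elem continuous_subtype_val i j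

lemma integrable_entry {d : ℕ} (ν : Measure (Matrix.unitaryGroup (Fin d) ℂ))
    [IsProbabilityMeasure ν] (i j : Fin d) (m : ℕ) :
    Integrable (fun U : Matrix.unitaryGroup (Fin d) ℂ =>
      ‖(U : Matrix (Fin d) (Fin d) ℂ) i j‖ ^ m) ν := by
  refine Integrable.of_bound (C := 1)
    ((continuous_entry i j).norm.pow m).measurable.aestronglyMeasurable ?_
  refine Filter.Eventually.of_forall fun U => ?_
  rw [norm_pow, norm_norm]
  exact pow_le_one₀ (norm_nonneg _) (entry_norm_bound_of_unitary U.2 i j)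

lemma column_norm {d : ℕ} (U : Matrix.unitaryGroup (Fin d) ℂ) (j : Fin d) :
    ∑ k, ‖(U : Matrix (Fin d) (Fin d) ℂ) k j‖ ^ 2 = 1 := by
  have h := Matrix.mem_unitaryGroup_iff'.1 U.2
  have h2 := congrFun (congrFun h j) j
  rw [Matrix.mul_apply, Matrix.one_apply_eq] at h2
  have h3 : ((∑ k, ‖(U : Matrix (Fin d) (Fin d) ℂ) k j‖ ^ 2 : ℝ) : ℂ) = 1 := by
    rw [← h2]
    push_cast
    refine Finset.sum_congr rfl fun k _ => ?_
    rw [Matrix.star_apply, RCLike.star_def, Complex.conj_mul']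
  exact_mod_cast h3

lemma haar_moment {d t : ℕ} (hd : 0 < d) (μH : Measure (Matrix.unitaryGroup (Fin d) ℂ))
    [μH.IsHaarMeasure] [IsProbabilityMeasure μH] (i j : Fin d) :
    ∫ U : Matrix.unitaryGroup (Fin d) ℂ, ‖(U : Matrix (Fin d) (Fin d) ℂ) i j‖ ^ (2 * t) ∂μH ≤
      t.factorial / (d : ℝ) ^ t := by
  set M := ∫ U : Matrix.unitaryGroup (Fin d) ℂ,
    ‖(U : Matrix (Fin d) (Fin d) ℂ) i j‖ ^ (2 * t) ∂μH with hM
  obtain ⟨ζ, hζ⟩ : ∃ ζ : ℂ, IsPrimitiveRoot ζ (t + 1) :=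
    ⟨_, Complex.isPrimitiveRoot_exp (t + 1) (by omega)⟩
  obtain ⟨η, hη⟩ : ∃ η : ℂ, IsPrimitiveRoot η d := ⟨_, Complex.isPrimitiveRoot_exp d hd.ne'⟩
  have hζn : ‖ζ‖ = 1 := hζ.norm'_eq_one (by omega)
  have hηn : ‖η‖ = 1 := hη.norm'_eq_one (by omega)
  let W : (Fin d → Fin (t + 1)) → Matrix.unitaryGroup (Fin d) ℂ := fun φ =>
    ⟨phaseDFT d η (fun k => ζ ^ (φ k : ℕ)), phaseDFT_mem hd hη _ (fun k => by simp [hζn])⟩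
  have hW : ∀ φ, ∫ U : Matrix.unitaryGroup (Fin d) ℂ,
      ‖((W φ * U : Matrix.unitaryGroup (Fin d) ℂ) : Matrix (Fin d) (Fin d) ℂ) i j‖ ^ (2 * t) ∂μH
        = M := fun φ =>
    integral_mul_left_eq_self
      (fun U : Matrix.unitaryGroup (Fin d) ℂ =>
        ‖(U : Matrix (Fin d) (Fin d) ℂ) i j‖ ^ (2 * t)) (W φ)
  have hint : ∀ φ, Integrable (fun U : Matrix.unitaryGroup (Fin d) ℂ =>
      ‖((W φ * U : Matrix.unitaryGroup (Fin d) ℂ) : Matrix (Fin d) (Fin d) ℂ) i j‖ ^ (2 * t))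
        μH := fun φ => (integrable_entry μH i j (2 * t)).comp_mul_left (W φ)
  have hsum : ∫ U : Matrix.unitaryGroup (Fin d) ℂ, ∑ φ,
      ‖((W φ * U : Matrix.unitaryGroup (Fin d) ℂ) : Matrix (Fin d) (Fin d) ℂ) i j‖ ^ (2 * t) ∂μH
        = ((t : ℝ) + 1) ^ d * M := by
    rw [integral_finsetSum _ fun φ _ => hint φ, Finset.sum_congr rfl fun φ _ => hW φ]
    simp
  have hpt : ∀ U : Matrix.unitaryGroup (Fin d) ℂ, ∑ φ,
      ‖((W φ * U : Matrix.unitaryGroup (Fin d) ℂ) : Matrix (Fin d) (Fin d) ℂ) i j‖ ^ (2 * t)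
        ≤ ((t : ℝ) + 1) ^ d * (t.factorial / (d : ℝ) ^ t) := by
    intro U
    have hst := steinhaus hζ (fun k => ((Real.sqrt d : ℝ) : ℂ)⁻¹ * η ^ ((i : ℕ) * (k : ℕ)) *
      (U : Matrix (Fin d) (Fin d) ℂ) k j)
    have e1 : ∑ k : Fin d, ‖((Real.sqrt d : ℝ) : ℂ)⁻¹ * η ^ ((i : ℕ) * (k : ℕ)) *
      (U : Matrix (Fin d) (Fin d) ℂ) k j‖ ^ 2 = (d : ℝ)⁻¹ := by
      rw [← mul_one (d : ℝ)⁻¹, ← column_norm U j, Finset.mul_sum]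
      refine Finset.sum_congr rfl fun k _ => ?_
      rw [norm_mul, norm_mul, norm_pow, hηn, one_pow, mul_one, mul_pow, norm_inv,
        Complex.norm_real, Real.norm_of_nonneg (Real.sqrt_nonneg _), inv_pow,
        Real.sq_sqrt (by positivity)]
    rw [e1] at hst
    refine le_trans (le_of_eq ?_) (hst.trans (le_of_eq ?_))
    · refine Finset.sum_congr rfl fun φ _ => ?_
      congr 2
      change ((phaseDFT d η (fun k => ζ ^ (φ k : ℕ))) * (U : Matrix (Fin d) (Fin d) ℂ)) i j = _
      rw [Matrix.mul_apply]
      refine Finset.sum_congr rfl fun k _ => ?_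
      simp only [phaseDFT]
      ring
    · rw [inv_pow, div_eq_mul_inv]
  have hle : ((t : ℝ) + 1) ^ d * M ≤ ((t : ℝ) + 1) ^ d * (t.factorial / (d : ℝ) ^ t) := by
    rw [← hsum]
    refine (integral_mono (integrable_finsetSum _ fun φ _ => hint φ)
      (integrable_const _) hpt).trans (le_of_eq ?_)
    simp
  exact le_of_mul_le_mul_left hle (by positivity)

lemma moment_entry {d t : ℕ} (ν : Measure (Matrix.unitaryGroup (Fin d) ℂ)) (i j : Fin d) :
    momentSuper d t ν (Matrix.single (fun _ => j) (fun _ => j) 1) (fun _ => i) (fun _ => i) =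
      ((∫ U : Matrix.unitaryGroup (Fin d) ℂ,
        ‖(U : Matrix (Fin d) (Fin d) ℂ) i j‖ ^ (2 * t) ∂ν : ℝ) : ℂ) := by
  rw [← integral_complex_ofReal]
  unfold momentSuper
  congr 1
  funext U
  rw [Matrix.mul_apply, Finset.sum_eq_single (fun _ => j)]
  · rw [Matrix.mul_single_apply_same, Matrix.conjTranspose_apply]
    simp only [tensorPow, Finset.prod_const, Finset.card_univ, Fintype.card_fin, mul_one,
      RCLike.star_def, map_pow]
    rw [← mul_pow, Complex.mul_conj', ← pow_mul]
    push_cast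
    rfl
  · intro y _ hy
    rw [Matrix.mul_single_apply_of_ne _ _ _ _ _ hy, zero_mul]
  · intro h; exact absurd (Finset.mem_univ _) h

lemma norm_entry_le_frob {α : Type*} [Fintype α] (M : Matrix α α ℂ) (x y : α) :
    ‖M x y‖ ≤ frobNorm M := by
  unfold frobNorm
  apply Real.le_sqrt_of_sq_le
  refine le_trans ?_ (Finset.single_le_sum (f := fun x => ∑ y, ‖M x y‖ ^ 2)
    (fun _ _ => Finset.sum_nonneg fun _ _ => by positivity) (Finset.mem_univ x))
  exact Finset.single_le_sum (f := fun y => ‖M x y‖ ^ 2)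
    (fun _ _ => by positivity) (Finset.mem_univ y)

lemma frob_single {α : Type*} [Fintype α] [DecidableEq α] (x : α) :
    frobNorm (Matrix.single x x (1 : ℂ)) = 1 := by
  unfold frobNorm
  rw [Finset.sum_eq_single x, Finset.sum_eq_single x]
  · simp
  · intro y _ hy
    simp [hy.symm]
  · simp
  · intro y _ hy
    simp [hy.symm]
  · simp

/-- If `μ` is a `2^{-3tn}`-approximate unitary `t`-design on `U(2^n)`, then for
every `0 ≤ β ≤ 1` all but a `(1 + t!)·2^{-(t(1-β)-2)n}` fraction of its elements satisfy
`C(U) ≥ βn`, i.e. the `μ`-probability that `max_{i,j} |U_{i,j}|² ≥ 2^{-βn}` is at most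
`(1 + t!)·2^{-(t(1-β)-2)n}`. -/
theorem design_most_elements_flat (n t : ℕ) (hn : 1 ≤ n) (ht : 1 ≤ t)
    (μ : Measure (Matrix.unitaryGroup (Fin (2 ^ n)) ℂ)) [IsProbabilityMeasure μ]
    (μH : Measure (Matrix.unitaryGroup (Fin (2 ^ n)) ℂ))
    [μH.IsHaarMeasure] [IsProbabilityMeasure μH]
    (hdesign : ∀ X : Matrix (Fin t → Fin (2 ^ n)) (Fin t → Fin (2 ^ n)) ℂ,
      frobNorm (momentSuper (2 ^ n) t μ X - momentSuper (2 ^ n) t μH X) ≤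
        ((2 : ℝ) ^ (3 * t * n))⁻¹ * frobNorm X)
    (β : ℝ) (hβ0 : 0 ≤ β) (hβ1 : β ≤ 1) :
    μ {U : Matrix.unitaryGroup (Fin (2 ^ n)) ℂ |
        ∃ i j, (2 : ℝ) ^ (-(β * n)) ≤ ‖(U : Matrix (Fin (2 ^ n)) (Fin (2 ^ n)) ℂ) i j‖ ^ 2}
      ≤ ENNReal.ofReal
          ((1 + (t.factorial : ℝ)) * (2 : ℝ) ^ (-((t : ℝ) * (1 - β) - 2) * n)) := by
  obtain ⟨d, hd⟩ : ∃ d, 2 ^ n = d := ⟨_, rfl⟩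
  revert μ μH
  rw [hd]
  intro μ _ μH _ _ hdesign
  have hd0 : 0 < d := by rw [← hd]; positivity
  have hmom : ∀ i j : Fin d, ∫ U : Matrix.unitaryGroup (Fin d) ℂ,
      ‖(U : Matrix (Fin d) (Fin d) ℂ) i j‖ ^ (2 * t) ∂μ ≤
        (1 + t.factorial) / (d : ℝ) ^ t := by
    intro i j
    have h1 := (norm_entry_le_frob _ (fun _ => i) (fun _ => i)).trans
      (hdesign (Matrix.single (fun _ => j) (fun _ => j) 1))
    rw [frob_single, mul_one, Matrix.sub_apply, moment_entry, moment_entry,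
      ← Complex.ofReal_sub, Complex.norm_real, Real.norm_eq_abs] at h1
    have h2 := (abs_le.1 h1).2
    have h3 := haar_moment (t := t) hd0 μH i j
    have h4 : ((2 : ℝ) ^ (3 * t * n))⁻¹ ≤ 1 / (d : ℝ) ^ t := by
      rw [one_div]
      apply inv_anti₀ (by positivity)
      rw [← hd]
      push_cast
      rw [← pow_mul]
      apply pow_le_pow_right₀ (by norm_num)
      nlinarith [Nat.zero_le (n * t)]
    rw [add_div]
    linarith
  have hmark : ∀ i j : Fin d, μ.real {U : Matrix.unitaryGroup (Fin d) ℂ |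
        (2 : ℝ) ^ (-(β * n)) ≤ ‖(U : Matrix (Fin d) (Fin d) ℂ) i j‖ ^ 2} ≤
        ((2 : ℝ) ^ (-(β * n) * t))⁻¹ * ((1 + t.factorial) / (d : ℝ) ^ t) := by
    intro i j
    have h1 := (mul_meas_ge_le_integral_of_nonneg (μ := μ)
      (Filter.Eventually.of_forall fun U => by positivity) (integrable_entry μ i j (2 * t))
      ((2 : ℝ) ^ (-(β * n) * t))).trans (hmom i j)
    have hset : μ.real {U : Matrix.unitaryGroup (Fin d) ℂ |
        (2 : ℝ) ^ (-(β * n)) ≤ ‖(U : Matrix (Fin d) (Fin d) ℂ) i j‖ ^ 2} ≤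
        μ.real {U : Matrix.unitaryGroup (Fin d) ℂ |
        (2 : ℝ) ^ (-(β * n) * t) ≤ ‖(U : Matrix (Fin d) (Fin d) ℂ) i j‖ ^ (2 * t)} := by
      refine measureReal_mono fun U hU => ?_
      rw [Set.mem_ofPred_eq] at hU ⊢
      rw [Real.rpow_mul (by norm_num), Real.rpow_natCast, pow_mul]
      exact pow_le_pow_left₀ (by positivity) hU t
    refine hset.trans ?_
    rw [inv_mul_eq_div, le_div_iff₀ (by positivity), mul_comm]
    exact h1
  have hsub : {U : Matrix.unitaryGroup (Fin d) ℂ |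
        ∃ i j, (2 : ℝ) ^ (-(β * n)) ≤ ‖(U : Matrix (Fin d) (Fin d) ℂ) i j‖ ^ 2} =
      ⋃ i : Fin d, ⋃ j : Fin d, {U : Matrix.unitaryGroup (Fin d) ℂ |
        (2 : ℝ) ^ (-(β * n)) ≤ ‖(U : Matrix (Fin d) (Fin d) ℂ) i j‖ ^ 2} := by
    ext U
    simp
  rw [hsub, ← ofReal_measureReal]
  apply ENNReal.ofReal_le_ofReal
  refine (measureReal_iUnion_fintype_le _).trans ?_
  refine (Finset.sum_le_sum fun i _ => (measureReal_iUnion_fintype_le _).trans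
    (Finset.sum_le_sum fun j _ => hmark i j)).trans (le_of_eq ?_)
  simp only [Finset.sum_const, Finset.card_univ, Fintype.card_fin, nsmul_eq_mul]
  have hdr : (d : ℝ) = (2 : ℝ) ^ (n : ℝ) := by
    rw [← hd, Real.rpow_natCast]; push_cast; rfl
  have hdt : (d : ℝ) ^ t = (2 : ℝ) ^ ((n : ℝ) * t) := by
    rw [hdr, Real.rpow_mul (by norm_num), ← Real.rpow_natCast _ t]
  rw [hdt, hdr, ← Real.rpow_neg (by norm_num), div_eq_mul_inv, ← Real.rpow_neg (by norm_num)]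
  have : -((t : ℝ) * (1 - β) - 2) * n = n + n + (-(-(β * n) * t)) + (-((n : ℝ) * t)) := by ring
  rw [this, Real.rpow_add (by norm_num), Real.rpow_add (by norm_num), Real.rpow_add (by norm_num)]
  ring
end
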